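/- Let Y₁, Y₂, Y₃ be finite types, let P₁, P₂, P₃ be probability mass functions on them, let q₁ : Y₁ → [0,1], q₂ : Y₂ → [0,1], q₃ : Y₃ → [0,1], and let a ∈ [0,1/2] be such that H₀ := h₂(a) = ∑_{y_i} P_i(y_i)·h₂(q_i(y_i)) for each i ∈ {1,2,3}. Then ∑_{y₂} ∑_{y₃} P₂(y₂)·P₃(y₃)·h₂(q₂(y₂)⋆q₃(y₃)) − ∑_{y₁} ∑_{y₂} ∑_{y₃} P₁(y₁)·P₂(y₂)·P₃(y₃)·h₂(q₁(y₁)⋆q₂(y₂)⋆q₃(y₃)) ≤ −H₀²·(1 − H₀)². -/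

import Mathlib

noncomputable def h2 (p : ℝ) : ℝ := -p * Real.logb 2 p - (1 - p) * Real.logb 2 (1 - p)

noncomputable def bconv (a b : ℝ) : ℝ := a * (1 - b) + b * (1 - a)

open Real Filter Topology in
theorem aux_series {x : ℝ} (hx : |x| < 1) :
    HasSum (fun k : ℕ => (1 / ((2 * (k:ℝ) + 1) * (2 * k + 2))) * (x ^ 2) ^ (k + 1))
      (log 2 - binEntropy ((1 - x) / 2)) := by
  have h1 := (hasSum_log_sub_log_of_abs_lt_one hx).mul_left (x / 2)
  have hx2 : |x ^ 2| < 1 := by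
    rw [abs_pow]; exact pow_lt_one₀ (abs_nonneg _) hx (by norm_num)
  have h2 := (hasSum_pow_div_log_of_abs_lt_one hx2).mul_left (1 / 2)
  have h3 := h1.sub h2
  obtain ⟨ha, hb⟩ := abs_lt.1 hx
  convert! h3 using 1
  · funext k
    have : (k:ℝ) + 1 ≠ 0 := by positivity
    have : 2 * (k:ℝ) + 1 ≠ 0 := by positivity
    rw [← pow_mul]
    have e : x ^ (2 * (k + 1)) = x * x ^ (2 * k + 1) := by ring
    rw [e]
    field_simp
    ring
  · have e1 : 1 - x ^ 2 = (1 + x) * (1 - x) := by ring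
    rw [e1, log_mul (by linarith) (by linarith), binEntropy, log_inv, log_inv]
    have e2 : 1 - (1 - x) / 2 = (1 + x) / 2 := by ring
    rw [e2, log_div (by linarith) (by norm_num), log_div (by linarith) (by norm_num)]
    ring

theorem aux_coef_nonneg (k : ℕ) : 0 ≤ (1 / ((2 * (k:ℝ) + 1) * (2 * k + 2))) := by positivity

open Real Filter Topology in
theorem aux_series_one :
    HasSum (fun k : ℕ => (1 / ((2 * (k:ℝ) + 1) * (2 * k + 2)))) (log 2) := by
  have hne : (𝓝[Set.Ioo (0:ℝ) 1] 1).NeBot := by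
    rw [nhdsWithin_Ioo_eq_nhdsLT (by norm_num)]; infer_instance
  have hb : ∀ N : ℕ, ∑ k ∈ Finset.range N, (1 / ((2 * (k:ℝ) + 1) * (2 * k + 2))) ≤ log 2 := by
    intro N
    have ht : Tendsto (fun x : ℝ => ∑ k ∈ Finset.range N,
        (1 / ((2 * (k:ℝ) + 1) * (2 * k + 2))) * (x ^ 2) ^ (k + 1)) (𝓝[Set.Ioo (0:ℝ) 1] 1)
        (𝓝 (∑ k ∈ Finset.range N, (1 / ((2 * (k:ℝ) + 1) * (2 * k + 2))) * ((1:ℝ) ^ 2) ^ (k + 1))) := by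
      apply Tendsto.mono_left _ nhdsWithin_le_nhds
      apply Continuous.tendsto
        (f := fun x : ℝ => ∑ k ∈ Finset.range N,
          (1 / ((2 * (k:ℝ) + 1) * (2 * k + 2))) * (x ^ 2) ^ (k + 1))
      fun_prop
    simp only [one_pow, mul_one] at ht
    refine le_of_tendsto ht ?_
    filter_upwards [self_mem_nhdsWithin] with x hx
    have hx1 : |x| < 1 := by rw [abs_lt]; constructor <;> linarith [hx.1, hx.2]
    have := sum_le_hasSum (Finset.range N)
      (fun k _ => mul_nonneg (aux_coef_nonneg k) (by positivity)) (aux_series hx1)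
    have hB : 0 ≤ binEntropy ((1 - x) / 2) :=
      binEntropy_nonneg (by linarith [hx.2]) (by linarith [hx.1])
    linarith
  have hs : Summable (fun k : ℕ => (1 / ((2 * (k:ℝ) + 1) * (2 * k + 2)))) :=
    summable_of_sum_range_le aux_coef_nonneg hb
  have hle : ∑' k : ℕ, (1 / ((2 * (k:ℝ) + 1) * (2 * k + 2))) ≤ log 2 :=
    Real.tsum_le_of_sum_range_le aux_coef_nonneg hb
  have hge : log 2 ≤ ∑' k : ℕ, (1 / ((2 * (k:ℝ) + 1) * (2 * k + 2))) := by
    have ht : Tendsto (fun x : ℝ => log 2 - binEntropy ((1 - x) / 2)) (𝓝[Set.Ioo (0:ℝ) 1] 1)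
        (𝓝 (log 2 - binEntropy ((1 - 1) / 2))) := by
      apply Tendsto.mono_left _ nhdsWithin_le_nhds
      apply Continuous.tendsto (f := fun x : ℝ => log 2 - binEntropy ((1 - x) / 2))
      fun_prop
    simp only [sub_self, zero_div, binEntropy_zero, sub_zero] at ht
    refine le_of_tendsto ht ?_
    filter_upwards [self_mem_nhdsWithin] with x hx
    have hx1 : |x| < 1 := by rw [abs_lt]; constructor <;> linarith [hx.1, hx.2]
    refine hasSum_le (fun k => ?_) (aux_series hx1) hs.hasSum
    refine mul_le_of_le_one_right (aux_coef_nonneg k) ?_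
    apply pow_le_one₀ (by positivity)
    nlinarith [hx.1, hx.2]
  rw [le_antisymm hge hle]
  exact hs.hasSum

open Real Filter Topology in
theorem aux_series' {x : ℝ} (hx : |x| ≤ 1) :
    HasSum (fun k : ℕ => (1 / ((2 * (k:ℝ) + 1) * (2 * k + 2))) * (x ^ 2) ^ (k + 1))
      (log 2 - binEntropy ((1 - x) / 2)) := by
  rcases hx.lt_or_eq with h | h
  · exact aux_series h
  · have h2 : x ^ 2 = 1 := by rw [← sq_abs, h]; norm_num
    have h3 : binEntropy ((1 - x) / 2) = 0 := by
      rcases (abs_eq (by norm_num : (0:ℝ) ≤ 1)).1 h with h | h <;> rw [h] <;> norm_num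
    simp only [h2, h3, one_pow, mul_one, sub_zero]
    exact aux_series_one

theorem aux_cheb (c u v : ℕ → ℝ) (hc : ∀ k, 0 ≤ c k) (hu : Antitone u) (hv : Antitone v) (N : ℕ) :
    (∑ k ∈ Finset.range N, c k * u k) * (∑ k ∈ Finset.range N, c k * v k) ≤
      (∑ k ∈ Finset.range N, c k) * (∑ k ∈ Finset.range N, c k * (u k * v k)) := by
  induction N with
  | zero => simp
  | succ N ih =>
    have h : 0 ≤ ∑ k ∈ Finset.range N, c k * ((u k - u N) * (v k - v N)) := by
      apply Finset.sum_nonneg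
      intro k hk
      have hk' : k ≤ N := (Finset.mem_range.1 hk).le
      exact mul_nonneg (hc k) (mul_nonneg (sub_nonneg.2 (hu hk')) (sub_nonneg.2 (hv hk')))
    have e : ∑ k ∈ Finset.range N, c k * ((u k - u N) * (v k - v N)) =
        (∑ k ∈ Finset.range N, c k * (u k * v k)) - v N * (∑ k ∈ Finset.range N, c k * u k)
        - u N * (∑ k ∈ Finset.range N, c k * v k) + u N * v N * ∑ k ∈ Finset.range N, c k := by
      rw [Finset.mul_sum, Finset.mul_sum, Finset.mul_sum, ← Finset.sum_sub_distrib,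
        ← Finset.sum_sub_distrib, ← Finset.sum_add_distrib]
      exact Finset.sum_congr rfl fun k _ => by ring
    rw [e] at h
    have := mul_nonneg (hc N) h
    simp only [Finset.sum_range_succ]
    nlinarith

theorem aux_h2 (p : ℝ) : h2 p = Real.binEntropy p / Real.log 2 := by
  unfold h2 Real.binEntropy Real.logb
  rw [Real.log_inv, Real.log_inv]; ring

theorem aux_one_sub_h2 (p : ℝ) : 1 - h2 p = (Real.log 2 - Real.binEntropy p) / Real.log 2 := by
  have : Real.log 2 ≠ 0 := (Real.log_pos (by norm_num)).ne'
  rw [aux_h2]; field_simp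

theorem aux_abs {a : ℝ} (ha : a ∈ Set.Icc (0:ℝ) 1) : |1 - 2 * a| ≤ 1 := by
  rw [abs_le]; constructor <;> linarith [ha.1, ha.2]

theorem aux_bconv_mem {a b : ℝ} (ha : a ∈ Set.Icc (0:ℝ) 1) (hb : b ∈ Set.Icc (0:ℝ) 1) :
    bconv a b ∈ Set.Icc (0:ℝ) 1 := by
  obtain ⟨a0, a1⟩ := ha
  obtain ⟨b0, b1⟩ := hb
  unfold bconv
  constructor <;> nlinarith [mul_nonneg a0 b0, mul_nonneg (sub_nonneg.2 a1) (sub_nonneg.2 b1),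
    mul_nonneg a0 (sub_nonneg.2 b1), mul_nonneg b0 (sub_nonneg.2 a1)]

theorem aux_ser {a : ℝ} (ha : a ∈ Set.Icc (0:ℝ) 1) :
    HasSum (fun k : ℕ => (1 / ((2 * (k:ℝ) + 1) * (2 * k + 2))) * ((1 - 2 * a) ^ 2) ^ (k + 1))
      (Real.log 2 - Real.binEntropy a) := by
  have := aux_series' (aux_abs ha)
  rwa [show (1 - (1 - 2 * a)) / 2 = a by ring] at this

theorem aux_sq_le {a : ℝ} (ha : a ∈ Set.Icc (0:ℝ) 1) : (1 - 2 * a) ^ 2 ≤ 1 := by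
  nlinarith [ha.1, ha.2, mul_nonneg ha.1 (sub_nonneg.2 ha.2)]

theorem aux_A {a b : ℝ} (ha : a ∈ Set.Icc (0:ℝ) 1) (hb : b ∈ Set.Icc (0:ℝ) 1) :
    1 - h2 (bconv a b) ≤ (1 - 2 * a) ^ 2 * (1 - h2 b) := by
  rw [aux_one_sub_h2, aux_one_sub_h2, ← mul_div_assoc]
  have hl : 0 < Real.log 2 := Real.log_pos (by norm_num)
  gcongr
  refine hasSum_le (fun k => ?_) (aux_ser (aux_bconv_mem ha hb)) ((aux_ser hb).mul_left _)
  have e : (1 - 2 * bconv a b) ^ 2 = (1 - 2 * a) ^ 2 * (1 - 2 * b) ^ 2 := by unfold bconv; ring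
  rw [e, mul_pow, mul_left_comm]
  have h0 : ((1 - 2 * a) ^ 2) ^ (k + 1) ≤ (1 - 2 * a) ^ 2 :=
    pow_le_of_le_one (by positivity) (aux_sq_le ha) (by omega)
  have := aux_coef_nonneg k
  gcongr

theorem aux_B {a b : ℝ} (ha : a ∈ Set.Icc (0:ℝ) 1) (hb : b ∈ Set.Icc (0:ℝ) 1) :
    (1 - h2 a) * (1 - h2 b) ≤ 1 - h2 (bconv a b) := by
  have hl : 0 < Real.log 2 := Real.log_pos (by norm_num)
  have key : (Real.log 2 - Real.binEntropy a) * (Real.log 2 - Real.binEntropy b) ≤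
      Real.log 2 * (Real.log 2 - Real.binEntropy (bconv a b)) := by
    refine le_of_tendsto_of_tendsto'
      ((aux_ser ha).tendsto_sum_nat.mul (aux_ser hb).tendsto_sum_nat)
      (aux_series_one.tendsto_sum_nat.mul (aux_ser (aux_bconv_mem ha hb)).tendsto_sum_nat) ?_
    intro N
    have e : (1 - 2 * bconv a b) ^ 2 = (1 - 2 * a) ^ 2 * (1 - 2 * b) ^ 2 := by unfold bconv; ring
    simp only [e, mul_pow _ _ (_ + 1)]
    refine aux_cheb _ _ _ aux_coef_nonneg ?_ ?_ N
    · intro i j hij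
      exact pow_le_pow_of_le_one (by positivity) (aux_sq_le ha) (by omega)
    · intro i j hij
      exact pow_le_pow_of_le_one (by positivity) (aux_sq_le hb) (by omega)
  rw [aux_one_sub_h2, aux_one_sub_h2, aux_one_sub_h2, div_mul_div_comm,
    div_le_div_iff₀ (by positivity) hl]
  nlinarith

open Real in
theorem aux_D {p : ℝ} (h0 : 0 ≤ p) (h1 : p ≤ 1 / 2) : p * log p ≤ (1 - p) * log (1 - p) := by
  have hd : ∀ x ∈ Set.Ioo (0:ℝ) (1/2), HasDerivAt (fun p : ℝ => (1 - p) * log (1 - p) - p * log p)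
      (- log (x * (1 - x)) - 2) x := by
    intro x hx
    have hx0 : x ≠ 0 := hx.1.ne'
    have hx1 : 1 - x ≠ 0 := by linarith [hx.2]
    have d1 : HasDerivAt (fun p : ℝ => 1 - p) (-1) x := by
      simpa using (hasDerivAt_id x).const_sub 1
    have d2 := (hasDerivAt_mul_log hx1).comp x d1
    have d3 := d2.sub (hasDerivAt_mul_log hx0)
    refine HasDerivAt.congr_deriv d3 ?_
    rw [log_mul hx0 hx1]; ring
  have hc : ConcaveOn ℝ (Set.Icc (0:ℝ) (1/2)) (fun p : ℝ => (1 - p) * log (1 - p) - p * log p) := by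
    apply AntitoneOn.concaveOn_of_deriv (convex_Icc _ _)
    · have : Continuous (fun p : ℝ => (1 - p) * log (1 - p) - p * log p) :=
        (continuous_mul_log.comp (continuous_const.sub continuous_id)).sub continuous_mul_log
      exact this.continuousOn
    · rw [interior_Icc]
      exact fun x hx => (hd x hx).differentiableAt.differentiableWithinAt
    · rw [interior_Icc]
      intro x hx y hy hxy
      rw [(hd x hx).deriv, (hd y hy).deriv]
      have : log (x * (1 - x)) ≤ log (y * (1 - y)) := by
        apply log_le_log
        · have := hx.1; have : 0 < 1 - x := by linarith [hx.2]
          positivity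
        · nlinarith [hx.2, hy.2, hx.1, hy.1]
      linarith
  have := hc.2 (show (0:ℝ) ∈ Set.Icc (0:ℝ) (1/2) by norm_num)
    (show (1/2:ℝ) ∈ Set.Icc (0:ℝ) (1/2) by norm_num)
    (show 0 ≤ 1 - 2 * p by linarith) (show 0 ≤ 2 * p by linarith) (by ring)
  simp only [smul_eq_mul] at this
  norm_num at this
  rw [show 2 * p * (1/2) = p by ring] at this
  linarith

open Real in
theorem aux_C0 {p : ℝ} (h0 : 0 ≤ p) (h1 : p ≤ 1 / 2) :
    binEntropy p ^ 2 ≤ 4 * (p * (1 - p)) * log 2 ^ 2 := by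
  rcases h0.eq_or_lt with rfl | h0
  · simp
  have hd : ∀ x ∈ Set.Ioc (0:ℝ) (1/2), HasDerivAt (fun p : ℝ => binEntropy p ^ 2 / (p * (1 - p)))
      (binEntropy x * ((1 - x) * log (1 - x) - x * log x) / (x * (1 - x)) ^ 2) x := by
    intro x hx
    have hx0 : x ≠ 0 := hx.1.ne'
    have hx1 : 1 - x ≠ 0 := by linarith [hx.2]
    have d1 : HasDerivAt (fun p : ℝ => 1 - p) (-1) x := by
      simpa using (hasDerivAt_id x).const_sub 1
    have d2 := (hasDerivAt_id x).mul d1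
    have d3 := (hasDerivAt_binEntropy hx0 (by linarith [hx.2])).pow 2
    have d4 := d3.div d2 (mul_ne_zero hx0 hx1)
    refine HasDerivAt.congr_deriv d4 ?_
    simp only [id, Pi.mul_apply, Pi.pow_apply]
    congr 1
    have : binEntropy x = -(x * log x) - (1 - x) * log (1 - x) := by
      rw [binEntropy, log_inv, log_inv]; ring
    rw [this]
    push_cast
    ring
  have hm : MonotoneOn (fun p : ℝ => binEntropy p ^ 2 / (p * (1 - p))) (Set.Ioc (0:ℝ) (1/2)) := by
    apply monotoneOn_of_deriv_nonneg (convex_Ioc _ _)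
    · exact fun x hx => (hd x hx).continuousAt.continuousWithinAt
    · exact fun x hx => (hd x (interior_subset hx)).differentiableAt.differentiableWithinAt
    · intro x hx
      have hx := interior_subset hx
      rw [(hd x hx).deriv]
      have a1 := binEntropy_nonneg hx.1.le (by linarith [hx.2])
      have a2 := sub_nonneg.2 (aux_D hx.1.le hx.2)
      positivity
  have := hm ⟨h0, h1⟩ (show (1/2:ℝ) ∈ Set.Ioc (0:ℝ) (1/2) by norm_num) h1
  have e : binEntropy (1/2) = log 2 := by rw [one_div, binEntropy_two_inv]
  have hp : 0 < p * (1 - p) := mul_pos h0 (by linarith)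
  simp only [e] at this
  rw [div_le_iff₀ hp] at this
  norm_num at this
  linarith

theorem aux_C {p : ℝ} (hp : p ∈ Set.Icc (0:ℝ) 1) : h2 p ^ 2 ≤ 1 - (1 - 2 * p) ^ 2 := by
  have hl : 0 < Real.log 2 := Real.log_pos (by norm_num)
  rw [aux_h2, div_pow, div_le_iff₀ (by positivity)]
  rcases le_total p (1 / 2) with h | h
  · have := aux_C0 hp.1 h
    linarith
  · have := aux_C0 (p := 1 - p) (by linarith [hp.2]) (by linarith)
    rw [Real.binEntropy_one_sub] at this
    linarith

theorem aux_h2_le (p : ℝ) : 0 ≤ 1 - h2 p := by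
  rw [aux_one_sub_h2]
  have hl : 0 < Real.log 2 := Real.log_pos (by norm_num)
  exact div_nonneg (sub_nonneg.2 Real.binEntropy_le_log_two) hl.le

theorem aux_pt {a b c : ℝ} (ha : a ∈ Set.Icc (0:ℝ) 1) (hb : b ∈ Set.Icc (0:ℝ) 1)
    (hc : c ∈ Set.Icc (0:ℝ) 1) :
    h2 a ^ 2 * ((1 - h2 b) * (1 - h2 c)) ≤ h2 (bconv a (bconv b c)) - h2 (bconv b c) := by
  have h1 := aux_A ha (aux_bconv_mem hb hc)
  have h2' := aux_B hb hc
  have h3 := aux_C ha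
  have h4 := aux_h2_le (bconv b c)
  have h5 := mul_le_mul_of_nonneg_left h2' (sq_nonneg (h2 a))
  have h6 := mul_le_mul_of_nonneg_right h3 h4
  linarith

theorem T3_second_gap_condition {Y₁ Y₂ Y₃ : Type*} [Fintype Y₁] [Fintype Y₂] [Fintype Y₃]
    (P₁ : Y₁ → ℝ) (hP₁ : ∀ y, 0 ≤ P₁ y) (hP₁sum : ∑ y, P₁ y = 1)
    (P₂ : Y₂ → ℝ) (hP₂ : ∀ y, 0 ≤ P₂ y) (hP₂sum : ∑ y, P₂ y = 1)
    (P₃ : Y₃ → ℝ) (hP₃ : ∀ y, 0 ≤ P₃ y) (hP₃sum : ∑ y, P₃ y = 1)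
    (q₁ : Y₁ → ℝ) (hq₁ : ∀ y, q₁ y ∈ Set.Icc (0 : ℝ) 1)
    (q₂ : Y₂ → ℝ) (hq₂ : ∀ y, q₂ y ∈ Set.Icc (0 : ℝ) 1)
    (q₃ : Y₃ → ℝ) (hq₃ : ∀ y, q₃ y ∈ Set.Icc (0 : ℝ) 1)
    (a : ℝ) (ha : a ∈ Set.Icc (0 : ℝ) (1 / 2))
    (hEq₁ : h2 a = ∑ y, P₁ y * h2 (q₁ y))
    (hEq₂ : h2 a = ∑ y, P₂ y * h2 (q₂ y))
    (hEq₃ : h2 a = ∑ y, P₃ y * h2 (q₃ y)) :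
    (∑ y₂, ∑ y₃, P₂ y₂ * P₃ y₃ * h2 (bconv (q₂ y₂) (q₃ y₃))) -
      (∑ y₁, ∑ y₂, ∑ y₃, P₁ y₁ * P₂ y₂ * P₃ y₃ *
        h2 (bconv (q₁ y₁) (bconv (q₂ y₂) (q₃ y₃)))) ≤
      -((h2 a) ^ 2 * (1 - h2 a) ^ 2) := by
  have hsq : (h2 a) ^ 2 ≤ ∑ y, P₁ y * h2 (q₁ y) ^ 2 := by
    have h : 0 ≤ ∑ y, P₁ y * (h2 (q₁ y) - h2 a) ^ 2 :=
      Finset.sum_nonneg fun y _ => mul_nonneg (hP₁ y) (sq_nonneg _)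
    have e : ∑ y, P₁ y * (h2 (q₁ y) - h2 a) ^ 2 =
        ∑ y, P₁ y * h2 (q₁ y) ^ 2 - 2 * h2 a * ∑ y, P₁ y * h2 (q₁ y)
          + h2 a ^ 2 * ∑ y, P₁ y := by
      rw [Finset.mul_sum, Finset.mul_sum, ← Finset.sum_sub_distrib, ← Finset.sum_add_distrib]
      exact Finset.sum_congr rfl fun y _ => by ring
    rw [e, ← hEq₁, hP₁sum] at h
    linarith
  have e2 : ∑ y, P₂ y * (1 - h2 (q₂ y)) = 1 - h2 a := by
    simp only [mul_sub, mul_one, Finset.sum_sub_distrib]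
    rw [hP₂sum, ← hEq₂]
  have e3 : ∑ y, P₃ y * (1 - h2 (q₃ y)) = 1 - h2 a := by
    simp only [mul_sub, mul_one, Finset.sum_sub_distrib]
    rw [hP₃sum, ← hEq₃]
  have e4 : (∑ y₂, ∑ y₃, P₂ y₂ * P₃ y₃ * h2 (bconv (q₂ y₂) (q₃ y₃))) =
      ∑ y₁, ∑ y₂, ∑ y₃, P₁ y₁ * P₂ y₂ * P₃ y₃ * h2 (bconv (q₂ y₂) (q₃ y₃)) := by
    simp only [mul_assoc, ← Finset.mul_sum]
    rw [← Finset.sum_mul, hP₁sum, one_mul]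
  have e5 : (∑ y, P₁ y * h2 (q₁ y) ^ 2) * ((1 - h2 a) * (1 - h2 a)) =
      ∑ y₁, ∑ y₂, ∑ y₃, P₁ y₁ * P₂ y₂ * P₃ y₃ *
        (h2 (q₁ y₁) ^ 2 * ((1 - h2 (q₂ y₂)) * (1 - h2 (q₃ y₃)))) := by
    nth_rewrite 1 [← e2]
    rw [← e3, Finset.sum_mul_sum, Finset.sum_mul]
    refine Finset.sum_congr rfl fun y₁ _ => ?_
    rw [Finset.mul_sum]
    refine Finset.sum_congr rfl fun y₂ _ => ?_
    rw [Finset.mul_sum]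
    exact Finset.sum_congr rfl fun y₃ _ => by ring
  have h6 : (∑ y, P₁ y * h2 (q₁ y) ^ 2) * ((1 - h2 a) * (1 - h2 a)) ≤
      (∑ y₁, ∑ y₂, ∑ y₃, P₁ y₁ * P₂ y₂ * P₃ y₃ *
        h2 (bconv (q₁ y₁) (bconv (q₂ y₂) (q₃ y₃)))) -
      ∑ y₁, ∑ y₂, ∑ y₃, P₁ y₁ * P₂ y₂ * P₃ y₃ * h2 (bconv (q₂ y₂) (q₃ y₃)) := by
    rw [e5]
    simp only [← Finset.sum_sub_distrib, ← mul_sub]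
    refine Finset.sum_le_sum fun y₁ _ => Finset.sum_le_sum fun y₂ _ =>
      Finset.sum_le_sum fun y₃ _ => ?_
    exact mul_le_mul_of_nonneg_left (aux_pt (hq₁ y₁) (hq₂ y₂) (hq₃ y₃))
      (mul_nonneg (mul_nonneg (hP₁ y₁) (hP₂ y₂)) (hP₃ y₃))
  have h7 := mul_le_mul_of_nonneg_right hsq (mul_self_nonneg (1 - h2 a))
  rw [e4]
  linarith
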